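/- arXiv:2303.00560 — 3 statements merged into one kernel-verified Lean document; each statement's English description precedes it below -/
import Mathlib

section
/- Let X be a set, A a commutative ring, and q an indeterminate, and let ρ be a statistic on nonempty words over X that looks right with data (wt, lwt). Then for all nonempty words u = (u_1, …, u_a) and v = (v_1, …, v_b) over X, one has ρ(u·v) = q^{d·b} · ρ(u) · ρ(v) in A[q], where u·v denotes the concatenation of u and v, and d = Σ_{i=1}^{a} lwt(u·v, i). -/
/-!
STATEMENT 0: If ρ looks right with data (wt, lwt), then for nonempty words u, v,
ρ(u·v) = q^{d·b} · ρ(u) · ρ(v), where d = Σ_{i=1}^{a} lwt(u·v, i), a = |u|, b = |v|.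
-/

noncomputable section

/-- The statistic `ρ` attached to the weight data `(wt, lwt)`:
`ρ(w) = ∏_{i=1}^{ℓ} q^{lwt(w,i)·(ℓ−i)} · wt(w_i)` (here with 0-based positions). -/
def rhoStat {X A : Type*} [CommRing A] (wt : X → A) (lwt : List X → ℕ → ℕ)
    (w : List X) : Polynomial A :=
  ∏ i : Fin w.length,
    (Polynomial.X ^ (lwt w i * (w.length - 1 - (i : ℕ))) * Polynomial.C (wt (w.get i)))

/-- The locality requirement on `lwt` in the definition of a statistic that
"looks right": `lwt(w,i)` depends only on `(w_i, w_{i+1})` when `i < ℓ`, and only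
on `w_ℓ` when `i = ℓ` (0-based positions). -/
def IsLocal {X : Type*} (lwt : List X → ℕ → ℕ) : Prop :=
  ∃ (f : X → X → ℕ) (g : X → ℕ), ∀ (w : List X) (i : Fin w.length),
    lwt w i = if h : (i : ℕ) + 1 < w.length
      then f (w.get i) (w.get ⟨(i : ℕ) + 1, h⟩)
      else g (w.get i)

theorem statement0 {X A : Type*} [CommRing A]
    (wt : X → A) (lwt : List X → ℕ → ℕ) (hlocal : IsLocal lwt)
    (u v : List X) (hu : u ≠ []) (hv : v ≠ []) :
    rhoStat wt lwt (u ++ v) =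
      Polynomial.X ^ ((∑ i ∈ Finset.range u.length, lwt (u ++ v) i) * v.length) *
        (rhoStat wt lwt u * rhoStat wt lwt v) := by
  obtain ⟨f, g, hfg⟩ := hlocal
  have hlen : u.length + v.length = (u ++ v).length := List.length_append.symm
  have hleft : ∀ i : Fin u.length, lwt (u ++ v) i * ((u ++ v).length - 1 - (i : ℕ)) =
      lwt (u ++ v) i * v.length + lwt u i * (u.length - 1 - (i : ℕ)) := by
    intro i
    have hi := i.isLt
    have hsub : (u ++ v).length - 1 - (i : ℕ) = v.length + (u.length - 1 - i) := by omega
    rw [hsub, mul_add]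
    congr 1
    by_cases h : (i : ℕ) + 1 < u.length
    · have h₁ := hfg (u ++ v) ⟨i, by omega⟩
      have h₂ := hfg u i
      rw [dif_pos (by simp only; omega)] at h₁
      rw [dif_pos h] at h₂
      simp only [List.get_eq_getElem, List.getElem_append_left hi,
        List.getElem_append_left h] at h₁ h₂
      rw [h₁, h₂]
    · have hz : u.length - 1 - (i : ℕ) = 0 := by omega
      simp [hz]
  have hright : ∀ j : Fin v.length, lwt (u ++ v) (u.length + j) = lwt v j := by
    intro j
    have h₁ := hfg (u ++ v) ⟨u.length + j, by omega⟩
    have h₂ := hfg v j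
    rw [h₁, h₂]
    by_cases h : (j : ℕ) + 1 < v.length
    · rw [dif_pos (by simp only; omega), dif_pos h]
      simp [List.getElem_append_right, add_assoc]
    · rw [dif_neg (by simp only; omega), dif_neg h]
      simp
  simp only [rhoStat]
  rw [← (finCongr hlen).prod_comp, Fin.prod_univ_add, ← mul_assoc]
  congr 1
  · rw [Finset.sum_range, Finset.sum_mul, ← Finset.prod_pow_eq_pow_sum,
      ← Finset.prod_mul_distrib]
    refine Finset.prod_congr rfl fun i _ => ?_
    simp only [finCongr_apply, Fin.val_cast, Fin.val_castAdd, hleft, pow_add, mul_assoc]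
    simp
  · refine Finset.prod_congr rfl fun j _ => ?_
    have hsub : (u ++ v).length - 1 - (u.length + (j : ℕ)) = v.length - 1 - j := by omega
    simp only [finCongr_apply, Fin.val_cast, Fin.val_natAdd, hright, hsub]
    simp


end
end

section
/- Let ρ be a statistic on nonempty words over an alphabet X that looks right with data (wt, lwt). If a labeled column-composition tableau S can split and spl(S) = (S^1, S^2), then weight(S) = weight(S^1) · weight(S^2). -/
noncomputable section

/-- A labeled column-composition tableau, given by its composition `comp = α`,
its sequence of column sizes `cols = c`, and its labeling word `word = w`. -/
structure LCCT (X : Type*) where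
  comp : List ℕ
  cols : List ℕ
  word : List X

/-- The set (as a list) of proper partial sums `Σ(α)` of a composition. -/
def partialSumsProper (β : List ℕ) : List ℕ :=
  (List.range (β.length - 1)).map fun t => (β.take (t + 1)).sum

/-- Validity of a labeled column-composition tableau: the composition is a nonempty
list of positive integers, the columns and the word have length `|α|`, the columns
are weakly increasing, and `c_i < c_{i+1}` only at positions in `Σ(α)`. -/
def IsLCCT {X : Type*} (S : LCCT X) : Prop :=
  S.comp ≠ [] ∧ (∀ a ∈ S.comp, 0 < a) ∧
  S.cols.length = S.comp.sum ∧ S.word.length = S.comp.sum ∧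
  S.cols.Chain' (· ≤ ·) ∧
  ∀ i, i + 1 < S.cols.length → S.cols.getD i 0 < S.cols.getD (i + 1) 0 →
    (i + 1) ∈ partialSumsProper S.comp

/-- The weight `q^{|C|}·ρ(w)` of a labeled column-composition tableau. -/
def weightT {X A : Type*} [CommRing A] (wt : X → A) (lwt : List X → ℕ → ℕ)
    (S : LCCT X) : Polynomial A :=
  Polynomial.X ^ S.cols.sum * rhoStat wt lwt S.word

/-- `d = Σ_{i=1}^{a} lwt(w, i)` (0-based: positions `0,…,a-1`). -/
def splitD {X : Type*} (lwt : List X → ℕ → ℕ) (w : List X) (a : ℕ) : ℕ :=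
  ∑ i ∈ Finset.range a, lwt w i

/-- First component of the split of a labeled column-composition tableau. -/
def splitFst {X : Type*} (S : LCCT X) : LCCT X :=
  ⟨[S.comp.headD 0], S.cols.take (S.comp.headD 0), S.word.take (S.comp.headD 0)⟩

/-- Second component of the split: the remaining columns, each increased by
`d = Σ_{i=1}^{α₁} lwt(w, i)` cells. -/
def splitSnd {X : Type*} (lwt : List X → ℕ → ℕ) (S : LCCT X) : LCCT X :=
  ⟨S.comp.tail,
   (S.cols.drop (S.comp.headD 0)).map (· + splitD lwt S.word (S.comp.headD 0)),
   S.word.drop (S.comp.headD 0)⟩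

/-- `spl(S) = (S1, S2)`: `S` can split (has at least one bar), and `S1`, `S2` are
the two pieces of the split of `S`. -/
def IsSplitOf {X : Type*} (lwt : List X → ℕ → ℕ) (S S1 S2 : LCCT X) : Prop :=
  2 ≤ S.comp.length ∧ S1 = splitFst S ∧ S2 = splitSnd lwt S

end

/-- The exponent of `q` in the statistic attached to `(wt, lwt)`. -/
def rhoExponent {X : Type*} (lwt : List X → ℕ → ℕ) (w : List X) : ℕ :=
  ∑ i ∈ Finset.range w.length, lwt w i * (w.length - 1 - i)

theorem rhoStat_eq {X A : Type*} [CommRing A] (wt : X → A) (lwt : List X → ℕ → ℕ)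
    (w : List X) :
    rhoStat wt lwt w =
      Polynomial.X ^ rhoExponent lwt w * Polynomial.C (w.map wt).prod := by
  rw [rhoStat, Finset.prod_mul_distrib, Finset.prod_pow_eq_pow_sum, ← map_prod, rhoExponent,
    Finset.sum_range]
  congr 2
  simp [← List.prod_ofFn]

theorem IsLocal.append_left {X : Type*} {lwt : List X → ℕ → ℕ} (h : IsLocal lwt)
    (u v : List X) {i : ℕ} (hi : i + 1 < u.length) : lwt (u ++ v) i = lwt u i := by
  obtain ⟨f, g, h⟩ := h
  have hu := h u ⟨i, by omega⟩
  have huv := h (u ++ v) ⟨i, by simp; omega⟩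
  simp only at hu huv
  rw [dif_pos hi] at hu
  rw [dif_pos (by simp; omega)] at huv
  rw [hu, huv]
  simp [List.getElem_append_left, hi, Nat.lt_of_succ_lt hi]

theorem IsLocal.append_right {X : Type*} {lwt : List X → ℕ → ℕ} (h : IsLocal lwt)
    (u v : List X) {i : ℕ} (hi : i < v.length) :
    lwt (u ++ v) (u.length + i) = lwt v i := by
  obtain ⟨f, g, h⟩ := h
  have hv := h v ⟨i, hi⟩
  have huv := h (u ++ v) ⟨u.length + i, by simp; omega⟩
  simp only at hv huv
  rw [hv, huv]
  by_cases hi' : i + 1 < v.length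
  · rw [dif_pos hi', dif_pos (by simp; omega)]
    simp [List.getElem_append_right, add_assoc]
  · rw [dif_neg hi', dif_neg (by simp; omega)]
    simp

theorem rhoExponent_append {X : Type*} {lwt : List X → ℕ → ℕ} (h : IsLocal lwt)
    (u v : List X) :
    rhoExponent lwt (u ++ v) =
      rhoExponent lwt u + splitD lwt (u ++ v) u.length * v.length + rhoExponent lwt v := by
  rw [rhoExponent, List.length_append, Finset.sum_range_add, rhoExponent, rhoExponent, splitD,
    Finset.sum_mul, ← Finset.sum_add_distrib]
  congr 1
  · refine Finset.sum_congr rfl fun i hi => ?_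
    rw [Finset.mem_range] at hi
    have hsub : u.length + v.length - 1 - i = (u.length - 1 - i) + v.length := by omega
    rw [hsub, mul_add]
    congr 1
    by_cases hi' : i + 1 < u.length
    · rw [h.append_left u v hi']
    · have hzero : u.length - 1 - i = 0 := by omega
      simp [hzero]
  · refine Finset.sum_congr rfl fun i hi => ?_
    rw [h.append_right u v (Finset.mem_range.1 hi)]
    congr 1
    omega

/-!
STATEMENT 1: If ρ looks right with data (wt, lwt), and a labeled column-composition
tableau S can split with spl(S) = (S¹, S²), then weight(S) = weight(S¹)·weight(S²).
-/
theorem statement1 {X A : Type*} [CommRing A]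
    (wt : X → A) (lwt : List X → ℕ → ℕ) (hlocal : IsLocal lwt)
    (S S1 S2 : LCCT X) (hS : IsLCCT S) (hsplit : IsSplitOf lwt S S1 S2) :
    weightT wt lwt S = weightT wt lwt S1 * weightT wt lwt S2 := by
  obtain ⟨hne, -, hcols, hword, -, -⟩ := hS
  obtain ⟨-, rfl, rfl⟩ := hsplit
  obtain ⟨comp, cols, word⟩ := S
  cases comp with
  | nil => exact absurd rfl hne
  | cons a comp =>
    simp only [List.sum_cons] at hcols hword
    simp only [weightT, splitFst, splitSnd, List.headD_cons]
    have hlen : (word.take a).length = a := by simp; omega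
    have hdrop : (cols.drop a).length = (word.drop a).length := by simp; omega
    have hexp := rhoExponent_append hlocal (word.take a) (word.drop a)
    rw [List.take_append_drop, hlen, ← hdrop] at hexp
    have hprod : (word.map wt).prod =
        ((word.take a).map wt).prod * ((word.drop a).map wt).prod := by
      rw [← List.prod_append, ← List.map_append, List.take_append_drop]
    have hsum : ((cols.drop a).map (· + splitD lwt word a)).sum =
        (cols.drop a).sum + splitD lwt word a * (cols.drop a).length := by
      rw [List.sum_map_add, List.map_id', List.map_const', List.sum_replicate, smul_eq_mul,
        mul_comm]
    rw [rhoStat_eq, rhoStat_eq, rhoStat_eq, hexp, hprod, hsum,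
      ← List.sum_take_add_sum_drop cols a, map_mul]
    ring
end

section
/- Let ρ be a statistic on nonempty words over an alphabet X that looks right with data (wt, lwt). Let S^1 = (C^1, w^1) and S^2 = (C^2, w^2) be labeled column-composition tableaux such that the composition of C^1 has a single part. Then there exists a labeled column-composition tableau S with spl(S) = (S^1, S^2) if and only if c_1(C^2) ≥ c_{ℓ(C^1)}(C^1) + Σ_{j=1}^{ℓ(C^1)} lwt(w^1·w^2, j), where c_i(C) denotes the i-th column size of C and w^1·w^2 is the concatenated word. Moreover, when such an S exists it is unique. -/
theorem add_mem_partialSumsProper_cons {a m : ℕ} {β : List ℕ}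
    (h : m ∈ partialSumsProper β) : a + m ∈ partialSumsProper (a :: β) := by
  simp only [partialSumsProper, List.mem_map, List.mem_range] at h ⊢
  obtain ⟨t, ht, rfl⟩ := h
  exact ⟨t + 1, by simp; omega, by simp⟩

theorem head_mem_partialSumsProper_cons {a : ℕ} {β : List ℕ} (h : β ≠ []) :
    a ∈ partialSumsProper (a :: β) := by
  simp only [partialSumsProper, List.mem_map, List.mem_range]
  exact ⟨0, by simpa [List.length_pos_iff] using h, by simp⟩

theorem IsLCCT.cols_ne_nil {X : Type*} {S : LCCT X} (h : IsLCCT S) : S.cols ≠ [] := by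
  obtain ⟨hne, hpos, hlen, -⟩ := h
  obtain ⟨a, t, hc⟩ := List.exists_cons_of_ne_nil hne
  have ha : 0 < a := hpos a (by simp [hc])
  rintro hnil
  simp only [hnil, hc, List.length_nil, List.sum_cons] at hlen
  omega

/-- A tableau with a given split is the concatenation of the two pieces, up to the shift of the
columns of the second one. -/
theorem IsSplitOf.eq_append {X : Type*} {lwt : List X → ℕ → ℕ} {S S1 S2 : LCCT X}
    (hS : IsLCCT S) (h : IsSplitOf lwt S S1 S2) :
    S.comp = S1.comp ++ S2.comp ∧ S.word = S1.word ++ S2.word ∧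
      ∃ c, S.cols = S1.cols ++ c ∧
        S2.cols = c.map (· + splitD lwt (S1.word ++ S2.word) S1.cols.length) := by
  obtain ⟨hne, -, hlen, -⟩ := hS
  obtain ⟨-, rfl, rfl⟩ := h
  obtain ⟨comp, cols, word⟩ := S
  obtain ⟨a, t, rfl⟩ := List.exists_cons_of_ne_nil hne
  have ha : min a cols.length = a := by
    simp only [List.sum_cons] at hlen
    omega
  exact ⟨by simp [splitFst, splitSnd], by simp [splitFst, splitSnd], cols.drop a,
    by simp [splitFst], by simp [splitFst, splitSnd, ha]⟩

theorem IsSplitOf.unique {X : Type*} {lwt : List X → ℕ → ℕ} {S S' S1 S2 : LCCT X}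
    (hS : IsLCCT S) (hS' : IsLCCT S')
    (h : IsSplitOf lwt S S1 S2) (h' : IsSplitOf lwt S' S1 S2) : S = S' := by
  obtain ⟨hcomp, hword, c, hcols, hc⟩ := h.eq_append hS
  obtain ⟨hcomp', hword', c', hcols', hc'⟩ := h'.eq_append hS'
  have hcc : c = c' :=
    List.map_injective_iff.2 (add_left_injective _) (hc.symm.trans hc')
  obtain ⟨comp, cols, word⟩ := S
  obtain ⟨comp', cols', word'⟩ := S'
  simp_all

theorem IsSplitOf.getLastD_add_splitD_le {X : Type*} {lwt : List X → ℕ → ℕ}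
    {S S1 S2 : LCCT X} (hS : IsLCCT S) (h1 : IsLCCT S1) (h2 : IsLCCT S2)
    (h : IsSplitOf lwt S S1 S2) :
    S1.cols.getLastD 0 + splitD lwt (S1.word ++ S2.word) S1.cols.length
      ≤ S2.cols.headD 0 := by
  obtain ⟨-, -, c, hcols, hc⟩ := h.eq_append hS
  have hc0 : c ≠ [] := by
    rintro rfl
    exact h2.cols_ne_nil (by simpa using hc)
  obtain ⟨x, c, rfl⟩ := List.exists_cons_of_ne_nil hc0
  have hchain : List.IsChain (· ≤ ·) S.cols := hS.2.2.2.2.1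
  rw [hcols, List.isChain_append] at hchain
  have hle := hchain.2.2 (S1.cols.getLast h1.cols_ne_nil)
    (by simp [List.getLast?_eq_some_getLast h1.cols_ne_nil]) x (by simp)
  rw [List.getLastD_eq_getLast?, List.getLast?_eq_some_getLast h1.cols_ne_nil, hc]
  simpa using hle

/-- The tableau obtained by prepending a part of size `S1.cols.length` with the columns and the
letters of `S1`, after removing `d` cells from each column of `S2`. -/
def unsplit {X : Type*} (d : ℕ) (S1 S2 : LCCT X) : LCCT X :=
  ⟨S1.cols.length :: S2.comp, S1.cols ++ S2.cols.map (· - d), S1.word ++ S2.word⟩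

theorem le_of_mem_of_le_headD {l : List ℕ} {d x : ℕ} (hl : l.IsChain (· ≤ ·))
    (hd : d ≤ l.headD 0) (hx : x ∈ l) : d ≤ x := by
  cases l with
  | nil => simp at hx
  | cons y l =>
    rw [List.isChain_iff_pairwise, List.pairwise_cons] at hl
    rcases List.mem_cons.1 hx with rfl | hx
    · exact hd
    · exact hd.trans (hl.1 x hx)

theorem IsLCCT.unsplit {X : Type*} {d : ℕ} {S1 S2 : LCCT X} (h1 : IsLCCT S1)
    (h2 : IsLCCT S2) (hone : S1.comp.length = 1)
    (hd : S1.cols.getLastD 0 + d ≤ S2.cols.headD 0) : IsLCCT (unsplit d S1 S2) := by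
  have hpos1 := List.length_pos_iff.2 h1.cols_ne_nil
  obtain ⟨-, -, hlen1, hwlen1, hchain1, hjump1⟩ := h1
  obtain ⟨hne2, hpos2, hlen2, hwlen2, hchain2, hjump2⟩ := h2
  refine ⟨by simp [_root_.unsplit], ?_, by simp [_root_.unsplit, hlen2],
    by simp [_root_.unsplit, hwlen1, hlen1, hwlen2], ?_, ?_⟩
  · simpa only [_root_.unsplit, List.forall_mem_cons] using ⟨hpos1, hpos2⟩
  · refine List.isChain_append.2 ⟨hchain1, ?_, ?_⟩
    · exact (List.isChain_map _).2 (hchain2.imp fun _ _ h => Nat.sub_le_sub_right h d)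
    · intro x hx y hy
      cases hS : S2.cols with
      | nil => simp [hS] at hy
      | cons z l =>
        rw [List.getLastD_eq_getLast?, Option.mem_def.1 hx, hS] at hd
        simp only [hS, List.map_cons, List.head?_cons, Option.mem_def, Option.some.injEq] at hy
        simp only [Option.getD_some, List.headD_cons] at hd
        omega
  · intro i hi hlt
    simp only [_root_.unsplit] at hi hlt ⊢
    rcases lt_trichotomy (i + 1) S1.cols.length with h | h | h
    · rw [List.getD_append _ _ _ _ (by omega), List.getD_append _ _ _ _ h] at hlt
      simpa [partialSumsProper, hone] using hjump1 i h hlt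
    · rw [h]
      exact head_mem_partialSumsProper_cons hne2
    · obtain ⟨k, rfl⟩ : ∃ k, i = S1.cols.length + k := ⟨i - S1.cols.length, by omega⟩
      have hk : k + 1 < S2.cols.length := by
        simp only [List.length_append, List.length_map] at hi
        omega
      rw [add_assoc]
      refine add_mem_partialSumsProper_cons (hjump2 k hk ?_)
      rw [List.getD_append_right _ _ _ _ (by omega), List.getD_append_right _ _ _ _ (by omega),
        add_assoc, Nat.add_sub_cancel_left, Nat.add_sub_cancel_left,
        List.getD_eq_getElem _ _ (by simp; omega), List.getD_eq_getElem _ _ (by simpa using hk),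
        List.getElem_map, List.getElem_map] at hlt
      rw [List.getD_eq_getElem _ _ (by omega), List.getD_eq_getElem _ _ hk]
      omega

theorem isSplitOf_unsplit {X : Type*} {lwt : List X → ℕ → ℕ} {S1 S2 : LCCT X}
    (h1 : IsLCCT S1) (h2 : IsLCCT S2) (hone : S1.comp.length = 1)
    (hd : splitD lwt (S1.word ++ S2.word) S1.cols.length ≤ S2.cols.headD 0) :
    IsSplitOf lwt (unsplit (splitD lwt (S1.word ++ S2.word) S1.cols.length) S1 S2) S1 S2 := by
  obtain ⟨-, -, hlen1, hwlen1, -⟩ := h1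
  obtain ⟨hne2, -, -, -, hchain2, -⟩ := h2
  obtain ⟨comp1, cols1, word1⟩ := S1
  obtain ⟨comp2, cols2, word2⟩ := S2
  obtain ⟨a, rfl⟩ := List.length_eq_one_iff.1 hone
  simp only [List.sum_singleton] at hlen1 hwlen1
  have hw : word1.length = cols1.length := hwlen1.trans hlen1.symm
  refine ⟨?_, ?_, ?_⟩
  · have := List.length_pos_iff.2 hne2
    simp only [unsplit, List.length_cons] at this ⊢
    omega
  · simp [unsplit, splitFst, hlen1, hwlen1]
  · have hmap : (cols2.map (· - splitD lwt (word1 ++ word2) cols1.length)).map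
        (· + splitD lwt (word1 ++ word2) cols1.length) = cols2 := by
      rw [List.map_map]
      conv_rhs => rw [← List.map_id cols2]
      exact List.map_congr_left fun x hx =>
        Nat.sub_add_cancel (le_of_mem_of_le_headD hchain2 hd hx)
    simp only [unsplit, splitSnd, List.headD_cons, List.tail_cons, List.drop_left, hmap]
    simp [hw]

/-!
STATEMENT 2: Let S¹ = (C¹,w¹), S² = (C²,w²) be labeled column-composition tableaux
with the composition of C¹ having a single part. Then there exists S with
spl(S) = (S¹,S²) iff c₁(C²) ≥ c_{ℓ(C¹)}(C¹) + Σ_{j=1}^{ℓ(C¹)} lwt(w¹·w², j);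
moreover such an S, when it exists, is unique.
-/
theorem statement2 {X A : Type*} [CommRing A]
    (wt : X → A) (lwt : List X → ℕ → ℕ) (hlocal : IsLocal lwt)
    (S1 S2 : LCCT X) (h1 : IsLCCT S1) (h2 : IsLCCT S2)
    (hone : S1.comp.length = 1) :
    ((∃ S : LCCT X, IsLCCT S ∧ IsSplitOf lwt S S1 S2) ↔
      S1.cols.getLastD 0 + ∑ j ∈ Finset.range S1.cols.length, lwt (S1.word ++ S2.word) j
        ≤ S2.cols.headD 0) ∧
    (∀ S S' : LCCT X, IsLCCT S → IsLCCT S' →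
      IsSplitOf lwt S S1 S2 → IsSplitOf lwt S' S1 S2 → S = S') := by
  refine ⟨⟨?_, ?_⟩, fun S S' hS hS' h h' => h.unique hS hS' h'⟩
  · rintro ⟨S, hS, h⟩
    exact h.getLastD_add_splitD_le hS h1 h2
  · intro hle
    exact ⟨_, h1.unsplit h2 hone hle,
      isSplitOf_unsplit h1 h2 hone ((Nat.le_add_left _ _).trans hle)⟩
end
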